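/- The map p from the interior of C(p,q) (relative to 𝔲(p,q)) to ℝⁿ, which sends X to the unique x ∈ C_{p,q} with X ∈ O_x, is continuous. -/

import Mathlib

open Matrix Complex Pointwise

noncomputable def Ipq (p q : ℕ) : Matrix (Fin (p + q)) (Fin (p + q)) ℂ :=
  Matrix.diagonal fun i => if (i : ℕ) < p then 1 else -1

/-- The pseudo-unitary group `U(p,q)` as a set of matrices. -/
def Upq (p q : ℕ) : Set (Matrix (Fin (p + q)) (Fin (p + q)) ℂ) :=
  {g | IsUnit g ∧ g * Ipq p q * g.conjTranspose = Ipq p q}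

/-- The diagonal matrix with entries `i * x_k`. -/
noncomputable def dmat {n : ℕ} (x : Fin n → ℝ) : Matrix (Fin n) (Fin n) ℂ :=
  Matrix.diagonal fun i => Complex.I * (x i : ℂ)

/-- The holomorphic chamber `C_{p,q}`: `x_1 ≥ ⋯ ≥ x_p > x_{p+1} ≥ ⋯ ≥ x_{p+q}`. -/
def Chol (p q : ℕ) : Set (Fin (p + q) → ℝ) :=
  {x | (∀ i j : Fin (p + q), (i : ℕ) ≤ (j : ℕ) → ((j : ℕ) < p ∨ p ≤ (i : ℕ)) → x j ≤ x i) ∧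
       ∀ i j : Fin (p + q), (i : ℕ) < p → p ≤ (j : ℕ) → x j < x i}

/-- The adjoint orbit `O_x = {g d_x g⁻¹ : g ∈ U(p,q)}`. -/
def Orbit (p q : ℕ) (x : Fin (p + q) → ℝ) : Set (Matrix (Fin (p + q)) (Fin (p + q)) ℂ) :=
  {Y | ∃ g ∈ Upq p q, Y = g * dmat x * g⁻¹}

/-- The Lie algebra `𝔲(p,q)`. -/
def upqLie (p q : ℕ) : Set (Matrix (Fin (p + q)) (Fin (p + q)) ℂ) :=
  {X | X * Ipq p q + Ipq p q * X.conjTranspose = 0}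

/-- The invariant cone `C(p,q) ⊆ 𝔲(p,q)`. -/
def Cpq (p q : ℕ) : Set (Matrix (Fin (p + q)) (Fin (p + q)) ℂ) :=
  {X | X ∈ upqLie p q ∧ ∀ g ∈ Upq p q, 0 ≤ ((g * X * g⁻¹ * Ipq p q).trace).im}

/-- The interior of `C(p,q)` relative to the subspace `𝔲(p,q)`. -/
def interiorC (p q : ℕ) : Set (Matrix (Fin (p + q)) (Fin (p + q)) ℂ) :=
  {X | ∃ h : X ∈ upqLie p q,
    (⟨X, h⟩ : upqLie p q) ∈ interior (Subtype.val ⁻¹' Cpq p q)}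

open Filter Topology

theorem antitone_of_mem_Chol {p q : ℕ} {x : Fin (p + q) → ℝ} (hx : x ∈ Chol p q) : Antitone x := by
  intro i j hij
  by_cases h : (j : ℕ) < p ∨ p ≤ (i : ℕ)
  · exact hx.1 i j hij h
  · push Not at h
    exact (hx.2 i j h.2 h.1).le

/-- Antitone tuples are determined by the underlying multiset of their values. -/
theorem eq_of_antitone_of_map_univ_eq {n : ℕ} {x y : Fin n → ℝ} (hx : Antitone x)
    (hy : Antitone y) (h : Finset.univ.val.map x = Finset.univ.val.map y) : x = y := by
  have hperm : (List.ofFn x).Perm (List.ofFn y) := by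
    rw [← Multiset.coe_eq_coe]
    simpa [Fin.univ_val_map] using h
  exact List.ofFn_injective (hperm.eq_of_sortedGE hx.sortedGE_ofFn hy.sortedGE_ofFn)

/-- An antitone real tuple is determined by the polynomial with roots `i * x_k`. -/
theorem eq_of_antitone_of_prod_eq {n : ℕ} {x y : Fin n → ℝ} (hx : Antitone x) (hy : Antitone y)
    (h : ∀ z : ℂ, ∏ i, (z - Complex.I * (x i : ℂ)) = ∏ i, (z - Complex.I * (y i : ℂ))) :
    x = y := by
  have hpoly : ∏ i, (Polynomial.X - Polynomial.C (Complex.I * (x i : ℂ))) =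
      ∏ i, (Polynomial.X - Polynomial.C (Complex.I * (y i : ℂ))) :=
    Polynomial.funext fun z => by simpa [Polynomial.eval_prod] using h z
  have hroots (w : Fin n → ℂ) :
      (∏ i, (Polynomial.X - Polynomial.C (w i))).roots = Finset.univ.val.map w := by
    simpa [Finset.prod, Multiset.map_map, Function.comp_def] using
      Polynomial.roots_multiset_prod_X_sub_C (Finset.univ.val.map w)
  have hmap := congrArg Polynomial.roots hpoly
  rw [hroots, hroots] at hmap
  refine eq_of_antitone_of_map_univ_eq hx hy ?_
  simpa [Multiset.map_map, Function.comp_def] using congrArg (Multiset.map Complex.im) hmap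

theorem det_smul_one_sub_of_mem_Orbit {p q : ℕ} {x : Fin (p + q) → ℝ}
    {Y : Matrix (Fin (p + q)) (Fin (p + q)) ℂ} (hY : Y ∈ Orbit p q x) (z : ℂ) :
    (z • (1 : Matrix (Fin (p + q)) (Fin (p + q)) ℂ) - Y).det =
      ∏ i, (z - Complex.I * (x i : ℂ)) := by
  obtain ⟨g, ⟨hg, -⟩, rfl⟩ := hY
  have hconj : z • (1 : Matrix (Fin (p + q)) (Fin (p + q)) ℂ) - g * dmat x * g⁻¹ =
      g * (z • 1 - dmat x) * g⁻¹ := by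
    have hgg : g * g⁻¹ = 1 := Matrix.mul_nonsing_inv g ((Matrix.isUnit_iff_isUnit_det g).1 hg)
    simp [mul_sub, sub_mul, hgg]
  rw [hconj, Matrix.det_conj hg, dmat, Matrix.smul_one_eq_diagonal, Matrix.diagonal_sub,
    Matrix.det_diagonal]

theorem sum_sq_of_mem_Orbit {p q : ℕ} {x : Fin (p + q) → ℝ}
    {Y : Matrix (Fin (p + q)) (Fin (p + q)) ℂ} (hY : Y ∈ Orbit p q x) :
    ∑ i, x i ^ 2 = -(Y * Y).trace.re := by
  obtain ⟨g, ⟨hg, -⟩, rfl⟩ := hY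
  have hgg : g⁻¹ * g = 1 := Matrix.nonsing_inv_mul g ((Matrix.isUnit_iff_isUnit_det g).1 hg)
  have hsq : g * dmat x * g⁻¹ * (g * dmat x * g⁻¹) = g * (dmat x * dmat x) * g⁻¹ := by
    calc _ = g * dmat x * (g⁻¹ * g) * dmat x * g⁻¹ := by simp only [mul_assoc]
      _ = _ := by rw [hgg]; simp only [mul_assoc, one_mul]
  rw [hsq, Matrix.trace_mul_comm, ← mul_assoc, hgg, one_mul, dmat, Matrix.diagonal_mul_diagonal,
    Matrix.trace_diagonal, Complex.re_sum, ← Finset.sum_neg_distrib]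
  refine Finset.sum_congr rfl fun i _ => ?_
  simp [sq]

theorem statement9 (p q : ℕ) (hq : 1 ≤ q) (hpq : q ≤ p)
    (f : Matrix (Fin (p + q)) (Fin (p + q)) ℂ → Fin (p + q) → ℝ)
    (hf : ∀ X ∈ interiorC p q, f X ∈ Chol p q ∧ X ∈ Orbit p q (f X)) :
    ContinuousOn f (interiorC p q) := by
  intro X hX
  refine tendsto_iff_ultrafilter _ _ _ |>.2 fun u hu => ?_
  have huX : Tendsto id (u : Filter (Matrix (Fin (p + q)) (Fin (p + q)) ℂ)) (𝓝 X) :=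
    hu.trans nhdsWithin_le_nhds
  have huS : ∀ᶠ Y in u, Y ∈ interiorC p q := hu self_mem_nhdsWithin
  have hcont : Continuous fun Y : Matrix (Fin (p + q)) (Fin (p + q)) ℂ => -(Y * Y).trace.re := by
    fun_prop
  set R : ℝ := |-(X * X).trace.re| + 1
  have hbound : ∀ᶠ Y in u, f Y ∈ Set.Icc (fun _ => -R) (fun _ => R) := by
    have hlt : -(X * X).trace.re < R := (le_abs_self _).trans_lt (lt_add_one _)
    filter_upwards [huS, ((hcont.tendsto X).comp huX).eventually_lt_const hlt] with Y hY hYR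
    have hR : 1 ≤ R := le_add_of_nonneg_left (abs_nonneg _)
    have hle (i) : f Y i ^ 2 ≤ R ^ 2 := by
      have h1 : f Y i ^ 2 ≤ ∑ j, f Y j ^ 2 :=
        Finset.single_le_sum (f := fun j => f Y j ^ 2) (fun j _ => sq_nonneg _) (Finset.mem_univ i)
      rw [sum_sq_of_mem_Orbit (hf Y hY).2] at h1
      have h2 : -(Y * Y).trace.re < R := hYR
      nlinarith
    exact ⟨fun i => (abs_le.1 (abs_le_of_sq_le_sq (hle i) (by linarith))).1,
      fun i => (abs_le.1 (abs_le_of_sq_le_sq (hle i) (by linarith))).2⟩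
  obtain ⟨y, -, hy⟩ := isCompact_Icc.ultrafilter_le_nhds (u.map f) (le_principal_iff.2 hbound)
  have hy : Tendsto f u (𝓝 y) := hy
  have hyi (i) : Tendsto (fun Y => f Y i) u (𝓝 (y i)) := (tendsto_pi_nhds.1 hy) i
  have hanti : Antitone y := fun i j hij =>
    le_of_tendsto_of_tendsto (hyi j) (hyi i) (huS.mono fun Y hY => antitone_of_mem_Chol (hf Y hY).1 hij)
  have hyX : y = f X := by
    refine eq_of_antitone_of_prod_eq hanti (antitone_of_mem_Chol (hf X hX).1) fun z => ?_
    rw [← det_smul_one_sub_of_mem_Orbit (hf X hX).2 z]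
    have hdet : Continuous fun Y : Matrix (Fin (p + q)) (Fin (p + q)) ℂ =>
        (z • (1 : Matrix (Fin (p + q)) (Fin (p + q)) ℂ) - Y).det := by fun_prop
    have hprod : Continuous fun x : Fin (p + q) → ℝ => ∏ i, (z - Complex.I * (x i : ℂ)) := by
      fun_prop
    refine tendsto_nhds_unique ((hprod.tendsto y).comp hy)
      (((hdet.tendsto X).comp huX).congr' ?_)
    filter_upwards [huS] with Y hY
    exact det_smul_one_sub_of_mem_Orbit (hf Y hY).2 z
  exact hyX ▸ hy
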